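/- arXiv:1604.08435 — 2 statements merged into one kernel-verified Lean document; each statement's English description precedes it below -/
import Mathlib

section
/- Let P, Q ∈ ℕ with P,Q ≥ 2 and P+Q > 4, and let R = k[U,V,W]/(U^P + V^Q + UVW) over an algebraically closed field k of characteristic p > 0. Then the Hilbert–Kunz multiplicity of R is 3 - (P+Q-4)/(PQ-P-Q), and this number lies in the half-open interval [2,3). -/
open MvPolynomial

noncomputable section

/-- The defining ideal of the `T_{PQ∞}` singularity `k[U,V,W]/(U^P + V^Q + UVW)`. -/
def tpqRel (k : Type*) [Field k] (P Q : ℕ) : Ideal (MvPolynomial (Fin 3) k) :=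
  Ideal.span {X 0 ^ P + X 1 ^ Q + X 0 * X 1 * X 2}

namespace Tpq

/-- The monomial `s ^ A * t ^ B` of the polynomial ring `k[s, t]`. -/
def mon (k : Type*) [Field k] (A B : ℕ) : AddMonoidAlgebra k (ℕ × ℕ) :=
  AddMonoidAlgebra.single (A, B) 1

variable {k : Type*} [Field k]

lemma mon_mul_mon (A B A' B' : ℕ) : mon k A B * mon k A' B' = mon k (A + A') (B + B') := by
  simp [mon, AddMonoidAlgebra.single_mul_single]

lemma mon_pow (A B n : ℕ) : mon k A B ^ n = mon k (n * A) (n * B) := by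
  simp [mon, AddMonoidAlgebra.single_pow]

lemma mon_coeff (A B : ℕ) (z : ℕ × ℕ) :
    (mon k A B).coeff z = if (A, B) = z then 1 else 0 := by
  simp [mon, Finsupp.single_apply]

/-- The image of `W` in `k[s, t]`. -/
def wImage (k : Type*) [Field k] (D : ℕ) : AddMonoidAlgebra k (ℕ × ℕ) :=
  -(mon k D 0 + mon k 0 D)

/-- The map `k[U, V, W] → k[s, t]` given by `U ↦ s ^ (b + 1) * t`, `V ↦ s * t ^ (a + 1)` and
`W ↦ -(s ^ D + t ^ D)`. For `D = (a + 1) * (b + 1) - 1` it parametrizes the surface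
`U ^ (a + 2) + V ^ (b + 2) + U * V * W = 0`. -/
def param (k : Type*) [Field k] (a b D : ℕ) :
    MvPolynomial (Fin 3) k →ₐ[k] AddMonoidAlgebra k (ℕ × ℕ) :=
  aeval ![mon k (b + 1) 1, mon k 1 (a + 1), wImage k D]

@[simp] lemma param_X_zero (a b D : ℕ) : param k a b D (X 0) = mon k (b + 1) 1 := by
  simp [param]

@[simp] lemma param_X_one (a b D : ℕ) : param k a b D (X 1) = mon k 1 (a + 1) := by
  simp [param]

@[simp] lemma param_X_two (a b D : ℕ) : param k a b D (X 2) = wImage k D := by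
  simp [param]

lemma param_mem_ker {a b D : ℕ} (hD : D = a * b + a + b) :
    param k a b D (X 0 ^ (a + 2) + X 1 ^ (b + 2) + X 0 * X 1 * X 2) = 0 := by
  simp only [map_add, map_mul, map_pow, param_X_zero, param_X_one, param_X_two, wImage, mon_pow,
    mon_mul_mon, mul_neg, mul_add (mon k _ _)]
  have h1 : (a + 2) * (b + 1) = b + 1 + 1 + D := by rw [hD]; ring
  have h2 : (b + 2) * (a + 1) = 1 + (a + 1) + D := by rw [hD]; ring
  rw [h1, h2]
  have h3 : (a + 2) * 1 = 1 + (a + 1) + 0 := by ring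
  have h4 : (b + 2) * 1 = b + 1 + 1 + 0 := by ring
  rw [h3, h4]
  abel

/-- Monomials in `U` and `V` have distinct images in `k[s, t]`. -/
lemma param_rename_injective {a b D : ℕ} (hD : D = a * b + a + b) (hpos : 0 < D)
    (h : MvPolynomial (Fin 2) k) (hh : param k a b D (rename Fin.castSucc h) = 0) : h = 0 := by
  let g : (Fin 2 →₀ ℕ) →+ ℕ × ℕ :=
    { toFun := fun m => ((b + 1) * m 0 + m 1, m 0 + (a + 1) * m 1)
      map_zero' := by simp
      map_add' := fun m n => by
        simp only [Finsupp.add_apply, Prod.mk_add_mk, Prod.mk.injEq]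
        constructor <;> ring }
  have hg : Function.Injective g := by
    intro m n hmn
    have e1 : (b + 1) * m 0 + m 1 = (b + 1) * n 0 + n 1 := congrArg Prod.fst hmn
    have e2 : m 0 + (a + 1) * m 1 = n 0 + (a + 1) * n 1 := congrArg Prod.snd hmn
    have i0 : D * m 0 = D * n 0 := by
      zify at e1 e2 hD ⊢
      rw [hD]
      linear_combination ((a : ℤ) + 1) * e1 - e2
    have i0' : m 0 = n 0 := Nat.eq_of_mul_eq_mul_left hpos i0
    ext i
    fin_cases i
    · exact i0'
    · rw [i0'] at e1
      simpa using e1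
  let F : MvPolynomial (Fin 2) k →ₐ[k] AddMonoidAlgebra k (ℕ × ℕ) :=
    AddMonoidAlgebra.mapDomainAlgHom k k g
  have hF : (param k a b D).comp (rename Fin.castSucc) = F := by
    apply MvPolynomial.algHom_ext
    intro i
    have hFX : F (X i) = AddMonoidAlgebra.single (g (Finsupp.single i 1)) 1 := by
      exact AddMonoidAlgebra.mapDomain_single
    rw [hFX]
    fin_cases i
    · simp [g, mon]
    · have : (Fin.castSucc (1 : Fin 2)) = (1 : Fin 3) := rfl
      simp [g, mon, this]
  have h0 : F h = 0 := by rw [← hF]; exact hh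
  exact AddMonoidAlgebra.mapDomain_injective hg (h0.trans (map_zero F).symm)

/-- Modulo `U ^ P + V ^ Q + U * V * W`, the variable `W` can be eliminated after multiplying by a
power of `U * V`. -/
lemma exists_eliminate (P Q : ℕ) (g : MvPolynomial (Fin 3) k) :
    ∃ (n : ℕ) (h : MvPolynomial (Fin 2) k),
      (X 0 ^ P + X 1 ^ Q + X 0 * X 1 * X 2 : MvPolynomial (Fin 3) k) ∣
        (X 0 * X 1) ^ n * g - rename Fin.castSucc h := by
  have r0 : rename Fin.castSucc (X 0 : MvPolynomial (Fin 2) k) = X 0 := by simp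
  have r1 : rename Fin.castSucc (X 1 : MvPolynomial (Fin 2) k) = X 1 := by
    rw [rename_X]; rfl
  induction g using MvPolynomial.induction_on with
  | C c => exact ⟨0, C c, by simp⟩
  | add g₁ g₂ ih₁ ih₂ =>
    obtain ⟨n₁, h₁, c₁, e₁⟩ := ih₁
    obtain ⟨n₂, h₂, c₂, e₂⟩ := ih₂
    refine ⟨n₁ + n₂, (X 0 * X 1) ^ n₂ * h₁ + (X 0 * X 1) ^ n₁ * h₂,
      (X 0 * X 1) ^ n₂ * c₁ + (X 0 * X 1) ^ n₁ * c₂, ?_⟩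
    simp only [map_add, map_mul, map_pow, r0, r1]
    linear_combination (X 0 * X 1) ^ n₂ * e₁ + (X 0 * X 1) ^ n₁ * e₂
  | mul_X g i ih =>
    obtain ⟨n, h, c, e⟩ := ih
    fin_cases i
    · refine ⟨n, h * X 0, c * X 0, ?_⟩
      simp only [map_mul, r0, Fin.zero_eta]
      linear_combination X 0 * e
    · refine ⟨n, h * X 1, c * X 1, ?_⟩
      simp only [map_mul, r1, Fin.mk_one]
      linear_combination X 1 * e
    · refine ⟨n + 1, -h * (X 0 ^ P + X 1 ^ Q),
        (X 0 * X 1 * X 2) * c + rename Fin.castSucc h, ?_⟩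
      simp only [map_mul, map_neg, map_add, map_pow, r0, r1, Fin.reduceFinMk]
      linear_combination X 0 * X 1 * X 2 * e

lemma dvd_of_dvd_X_mul {i : Fin 3} {f g : MvPolynomial (Fin 3) k} (hf : ¬ X i ∣ f)
    (h : f ∣ X i * g) : f ∣ g := by
  obtain ⟨c, hc⟩ := h
  have hX : Prime (X i : MvPolynomial (Fin 3) k) := MvPolynomial.X_prime
  obtain h' | ⟨d, rfl⟩ := hX.dvd_or_dvd (⟨g, hc.symm⟩ : X i ∣ f * c)
  · exact absurd h' hf
  · refine ⟨d, mul_left_cancel₀ hX.ne_zero ?_⟩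
    rw [hc]; ring

lemma not_X_zero_dvd (a b : ℕ) :
    ¬ (X 0 : MvPolynomial (Fin 3) k) ∣ X 0 ^ (a + 2) + X 1 ^ (b + 2) + X 0 * X 1 * X 2 := by
  rintro ⟨c, hc⟩
  have := congrArg (eval ![0, 1, 0]) hc
  simp at this

lemma not_X_one_dvd (a b : ℕ) :
    ¬ (X 1 : MvPolynomial (Fin 3) k) ∣ X 0 ^ (a + 2) + X 1 ^ (b + 2) + X 0 * X 1 * X 2 := by
  rintro ⟨c, hc⟩
  have := congrArg (eval ![1, 0, 0]) hc
  simp at this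

/-- The parametrization induces an embedding of `k[U, V, W]/(U ^ P + V ^ Q + U * V * W)`. -/
lemma param_eq_zero_iff {a b D : ℕ} (hD : D = a * b + a + b) (hpos : 0 < D)
    (g : MvPolynomial (Fin 3) k) :
    param k a b D g = 0 ↔ g ∈ tpqRel k (a + 2) (b + 2) := by
  rw [tpqRel, Ideal.mem_span_singleton]
  constructor
  · intro hg
    obtain ⟨n, h, c, hc⟩ := exists_eliminate (a + 2) (b + 2) g
    have hh : param k a b D (rename Fin.castSucc h) = 0 := by
      have := congrArg (param k a b D) hc
      rw [map_sub, map_mul, hg, map_mul, param_mem_ker hD] at this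
      simpa using this
    rw [param_rename_injective hD hpos h hh, map_zero, sub_zero] at hc
    have hdvd : (X 0 ^ (a + 2) + X 1 ^ (b + 2) + X 0 * X 1 * X 2 : MvPolynomial (Fin 3) k) ∣
        (X 0 * X 1) ^ n * g := ⟨c, hc⟩
    clear hc hh
    induction n with
    | zero => simpa using hdvd
    | succ n ih =>
      refine ih (dvd_of_dvd_X_mul (not_X_zero_dvd a b) (dvd_of_dvd_X_mul (not_X_one_dvd a b) ?_))
      convert hdvd using 1
      ring
  · rintro ⟨c, rfl⟩
    rw [map_mul, param_mem_ker hD, zero_mul]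

/-- The exponents `(A, B)`, both positive, of the monomials `s ^ A * t ^ B` lying in the normal
monoid generated by `s ^ (b + 1) * t`, `s * t ^ (a + 1)`, `s ^ D` and `t ^ D`. -/
def IsInterior (b D A B : ℕ) : Prop := 0 < A ∧ 0 < B ∧ A ≡ (b + 1) * B [MOD D]

section Range

variable {a b D : ℕ}

lemma mon_ray_zero_mem_range (hD : D = a * b + a + b) (l : ℕ) :
    mon k (b + 1 + D * l) 1 ∈ (param k a b D).range ∧
      mon k (1 + D * l) (a + 1) ∈ (param k a b D).range := by
  have hU : mon k (b + 1) 1 ∈ (param k a b D).range := ⟨X 0, param_X_zero a b D⟩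
  have hV : mon k 1 (a + 1) ∈ (param k a b D).range := ⟨X 1, param_X_one a b D⟩
  have hW : wImage k D ∈ (param k a b D).range := ⟨X 2, param_X_two a b D⟩
  induction l with
  | zero => exact ⟨hU, hV⟩
  | succ l ih =>
    obtain ⟨ihU, ihV⟩ := ih
    constructor
    · have : mon k (b + 1 + D * (l + 1)) 1 = -(wImage k D * mon k (b + 1 + D * l) 1) -
          mon k (1 + D * l) (a + 1) * mon k 1 (a + 1) ^ b := by
        simp only [wImage, neg_mul, add_mul, mon_pow, mon_mul_mon, neg_neg]
        have e1 : D + (b + 1 + D * l) = b + 1 + D * (l + 1) := by ring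
        have e2 : 0 + (b + 1 + D * l) = 1 + D * l + b * 1 := by ring
        have e3 : a + 1 + b * (a + 1) = D + 1 := by rw [hD]; ring
        rw [e1, e2, e3]
        simp
      rw [this]
      exact sub_mem (neg_mem (mul_mem hW ihU)) (mul_mem ihV (pow_mem hV b))
    · have : mon k (1 + D * (l + 1)) (a + 1) =
          mon k (b + 1 + D * l) 1 * mon k (b + 1) 1 ^ a := by
        rw [mon_pow, mon_mul_mon]
        congr 1
        · rw [hD]; ring
        · ring
      rw [this]
      exact mul_mem ihU (pow_mem hU a)

lemma mon_ray_one_mem_range (hD : D = a * b + a + b) (l : ℕ) :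
    mon k 1 (a + 1 + D * l) ∈ (param k a b D).range ∧
      mon k (b + 1) (1 + D * l) ∈ (param k a b D).range := by
  have hU : mon k (b + 1) 1 ∈ (param k a b D).range := ⟨X 0, param_X_zero a b D⟩
  have hV : mon k 1 (a + 1) ∈ (param k a b D).range := ⟨X 1, param_X_one a b D⟩
  have hW : wImage k D ∈ (param k a b D).range := ⟨X 2, param_X_two a b D⟩
  induction l with
  | zero => exact ⟨hV, hU⟩
  | succ l ih =>
    obtain ⟨ihV, ihU⟩ := ih
    constructor
    · have : mon k 1 (a + 1 + D * (l + 1)) = -(wImage k D * mon k 1 (a + 1 + D * l)) -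
          mon k (b + 1) (1 + D * l) * mon k (b + 1) 1 ^ a := by
        simp only [wImage, neg_mul, add_mul, mon_pow, mon_mul_mon, neg_neg]
        have e1 : D + (a + 1 + D * l) = a + 1 + D * (l + 1) := by ring
        have e2 : 0 + (a + 1 + D * l) = 1 + D * l + a * 1 := by ring
        have e3 : b + 1 + a * (b + 1) = D + 1 := by rw [hD]; ring
        rw [e1, e2, e3]
        simp
      rw [this]
      exact sub_mem (neg_mem (mul_mem hW ihV)) (mul_mem ihU (pow_mem hU a))
    · have : mon k (b + 1) (1 + D * (l + 1)) =
          mon k 1 (a + 1 + D * l) * mon k 1 (a + 1) ^ b := by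
        rw [mon_pow, mon_mul_mon]
        congr 1
        · ring
        · rw [hD]; ring
      rw [this]
      exact mul_mem ihV (pow_mem hV b)

lemma mon_mem_range (hD : D = a * b + a + b) {A B : ℕ} (h : IsInterior b D A B) :
    mon k A B ∈ (param k a b D).range := by
  obtain ⟨hA, hB, hmod⟩ := h
  have hU : mon k (b + 1) 1 ∈ (param k a b D).range := ⟨X 0, param_X_zero a b D⟩
  have hV : mon k 1 (a + 1) ∈ (param k a b D).range := ⟨X 1, param_X_one a b D⟩
  obtain hle | hlt := le_or_gt ((b + 1) * B) A
  · obtain ⟨l, hl⟩ := (Nat.modEq_iff_dvd' hle).1 hmod.symm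
    obtain ⟨n, rfl⟩ : ∃ n, B = n + 1 := ⟨B - 1, by omega⟩
    have : mon k A (n + 1) = mon k (b + 1 + D * l) 1 * mon k (b + 1) 1 ^ n := by
      rw [mon_pow, mon_mul_mon]
      congr 1
      · rw [← hl, add_right_comm, ← Nat.sub_add_cancel hle]
        simp only [Nat.add_sub_cancel]
        ring
      · ring
    rw [this]
    exact mul_mem (mon_ray_zero_mem_range hD l).1 (pow_mem hU n)
  · obtain ⟨j, hj⟩ := (Nat.modEq_iff_dvd' hlt.le).1 hmod
    have hj' : (b + 1) * B = A + D * j := by omega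
    obtain hle' | hlt' := le_or_gt A j
    · obtain ⟨n, rfl⟩ : ∃ n, A = n + 1 := ⟨A - 1, by omega⟩
      obtain ⟨m, rfl⟩ := Nat.exists_eq_add_of_le hle'
      have hm : (b + 1) * B = (b + 1) * ((a + 1) * (n + 1)) + D * m := by
        rw [hj', hD]; ring
      have hdvd : b + 1 ∣ m := by
        have h1 : b + 1 ∣ D * m := (Nat.dvd_add_right (Dvd.intro _ rfl)).1 (Dvd.intro _ hm)
        have h2 : (a + 1) * (b + 1) * m = D * m + m := by rw [hD]; ring
        have h3 : b + 1 ∣ D * m + m := by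
          rw [← h2]
          exact ⟨(a + 1) * m, by ring⟩
        exact (Nat.dvd_add_right h1).1 h3
      obtain ⟨l, rfl⟩ := hdvd
      have hBl : B = (a + 1) * (n + 1) + D * l := by
        apply Nat.eq_of_mul_eq_mul_left (Nat.succ_pos b)
        rw [Nat.succ_eq_add_one, hm]
        ring
      have : mon k (n + 1) B = mon k 1 (a + 1 + D * l) * mon k 1 (a + 1) ^ n := by
        rw [mon_pow, mon_mul_mon]
        congr 1
        · ring
        · rw [hBl]; ring
      rw [this]
      exact mul_mem (mon_ray_one_mem_range hD l).1 (pow_mem hV n)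
    · obtain ⟨m, rfl⟩ := Nat.exists_eq_add_of_lt hlt'
      have hm : (b + 1) * B = (a + 1) * (b + 1) * j + (m + 1) := by
        rw [hj', hD]; ring
      have hdvd : b + 1 ∣ m + 1 :=
        (Nat.dvd_add_right ⟨(a + 1) * j, by ring⟩).1 (Dvd.intro _ hm)
      obtain ⟨i, hi⟩ := hdvd
      have hBi : B = (a + 1) * j + i := by
        apply Nat.eq_of_mul_eq_mul_left (Nat.succ_pos b)
        rw [Nat.succ_eq_add_one, hm, hi]
        ring
      have : mon k (j + m + 1) B = mon k (b + 1) 1 ^ i * mon k 1 (a + 1) ^ j := by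
        rw [mon_pow, mon_pow, mon_mul_mon]
        congr 1
        · rw [add_assoc, hi]; ring
        · rw [hBi]; ring
      rw [this]
      exact mul_mem (pow_mem hU i) (pow_mem hV j)

lemma IsInterior.add_left {A B : ℕ} (h : IsInterior b D A B) (n : ℕ) :
    IsInterior b D (A + D * n) B :=
  ⟨by have := h.1; omega, h.2.1, by simpa [Nat.ModEq] using h.2.2⟩

lemma IsInterior.add_right {A B : ℕ} (h : IsInterior b D A B) (n : ℕ) :
    IsInterior b D A (B + D * n) := by
  refine ⟨h.1, by have := h.2.1; omega, h.2.2.trans ?_⟩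
  have : (b + 1) * (B + D * n) = (b + 1) * B + D * ((b + 1) * n) := by ring
  rw [this]
  simp [Nat.ModEq]

lemma IsInterior.mul_zero {A B : ℕ} (h : IsInterior b D A B) (n : ℕ) :
    IsInterior b D (A + n * (b + 1)) (B + n) := by
  refine ⟨by have := h.1; omega, by have := h.2.1; omega, ?_⟩
  rw [mul_add (b + 1) B n, mul_comm n]
  exact h.2.2.add_right _

lemma IsInterior.mul_one (hD : D = a * b + a + b) {A B : ℕ} (h : IsInterior b D A B) (n : ℕ) :
    IsInterior b D (A + n) (B + n * (a + 1)) := by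
  refine ⟨by have := h.1; omega, by have := h.2.1; omega, ?_⟩
  have e : (b + 1) * (B + n * (a + 1)) = (b + 1) * B + n + D * n := by rw [hD]; ring
  rw [e]
  refine (h.2.2.add_right n).trans ?_
  simp [Nat.ModEq]

lemma IsInterior.of_add_left {A B n : ℕ} (h : IsInterior b D (A + D * n) B) (hA : 0 < A) :
    IsInterior b D A B :=
  ⟨hA, h.2.1, by simpa [Nat.ModEq] using h.2.2⟩

lemma IsInterior.of_add_right {A B n : ℕ} (h : IsInterior b D A (B + D * n)) (hB : 0 < B) :
    IsInterior b D A B := by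
  refine ⟨h.1, hB, h.2.2.trans ?_⟩
  have : (b + 1) * (B + D * n) = (b + 1) * B + D * ((b + 1) * n) := by ring
  rw [this]
  simp [Nat.ModEq]

lemma IsInterior.of_mul_zero {A B n : ℕ} (h : IsInterior b D (A + n * (b + 1)) (B + n))
    (hA : 0 < A) (hB : 0 < B) : IsInterior b D A B := by
  refine ⟨hA, hB, Nat.ModEq.add_right_cancel' (n * (b + 1)) ?_⟩
  have := h.2.2
  rwa [mul_add (b + 1) B n, mul_comm (b + 1) n] at this

lemma IsInterior.of_mul_one (hD : D = a * b + a + b) {A B n : ℕ}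
    (h : IsInterior b D (A + n) (B + n * (a + 1))) (hA : 0 < A) (hB : 0 < B) :
    IsInterior b D A B := by
  refine ⟨hA, hB, Nat.ModEq.add_right_cancel' n ?_⟩
  have e : (b + 1) * (B + n * (a + 1)) = (b + 1) * B + n + D * n := by rw [hD]; ring
  have := h.2.2
  rw [e] at this
  refine this.trans ?_
  simp [Nat.ModEq]

/-- The span of the interior monomials. -/
def interiorSpan (k : Type*) [Field k] (b D : ℕ) : Submodule k (AddMonoidAlgebra k (ℕ × ℕ)) :=
  Submodule.span k {x | ∃ A B, IsInterior b D A B ∧ x = mon k A B}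

lemma mul_mem_interiorSpan {y : AddMonoidAlgebra k (ℕ × ℕ)}
    (hy : ∀ A B, IsInterior b D A B → mon k A B * y ∈ interiorSpan k b D)
    {x : AddMonoidAlgebra k (ℕ × ℕ)} (hx : x ∈ interiorSpan k b D) :
    x * y ∈ interiorSpan k b D := by
  induction hx using Submodule.span_induction with
  | mem x h =>
    obtain ⟨A, B, hAB, rfl⟩ := h
    exact hy A B hAB
  | zero => simp
  | add x₁ x₂ _ _ h₁ h₂ => rw [add_mul]; exact add_mem h₁ h₂
  | smul c x _ h => rw [smul_mul_assoc]; exact Submodule.smul_mem _ c h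

lemma mon_mem_interiorSpan {A B : ℕ} (h : IsInterior b D A B) :
    mon k A B ∈ interiorSpan k b D :=
  Submodule.subset_span ⟨A, B, h, rfl⟩

lemma mul_param_X_mem_interiorSpan (hD : D = a * b + a + b) (i : Fin 3)
    {x : AddMonoidAlgebra k (ℕ × ℕ)} (hx : x ∈ interiorSpan k b D) :
    x * param k a b D (X i) ∈ interiorSpan k b D := by
  refine mul_mem_interiorSpan (fun A B h => ?_) hx
  fin_cases i
  · simp only [Fin.zero_eta, param_X_zero, mon_mul_mon]
    simpa using mon_mem_interiorSpan (h.mul_zero 1)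
  · simp only [Fin.mk_one, param_X_one, mon_mul_mon]
    simpa using mon_mem_interiorSpan (h.mul_one hD 1)
  · simp only [Fin.reduceFinMk, param_X_two, wImage, mul_neg, mul_add, mon_mul_mon]
    exact neg_mem (add_mem (by simpa using mon_mem_interiorSpan (h.add_left 1))
      (by simpa using mon_mem_interiorSpan (h.add_right 1)))

/-- The coordinate ring is spanned by the interior monomials and the powers of `W`. -/
lemma param_mem_sup (hD : D = a * b + a + b) (g : MvPolynomial (Fin 3) k) :
    param k a b D g ∈
      interiorSpan k b D ⊔ Submodule.span k (Set.range fun l : ℕ => wImage k D ^ l) := by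
  induction g using MvPolynomial.induction_on with
  | C c =>
    refine Submodule.mem_sup_right ?_
    have : param k a b D (C c) = c • wImage k D ^ 0 := by
      rw [pow_zero, ← MvPolynomial.algebraMap_eq, AlgHom.commutes, Algebra.algebraMap_eq_smul_one]
    rw [this]
    exact Submodule.smul_mem _ _ (Submodule.subset_span ⟨0, rfl⟩)
  | add g₁ g₂ h₁ h₂ => rw [map_add]; exact add_mem h₁ h₂
  | mul_X g i ih =>
    rw [map_mul]
    obtain ⟨x, hx, y, hy, hxy⟩ := Submodule.mem_sup.1 ih
    rw [← hxy, add_mul]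
    refine add_mem (Submodule.mem_sup_left (mul_param_X_mem_interiorSpan hD i hx)) ?_
    clear hxy ih
    have key : ∀ l : ℕ, wImage k D ^ l * param k a b D (X i) ∈
        interiorSpan k b D ⊔ Submodule.span k (Set.range fun l : ℕ => wImage k D ^ l) := by
      intro l
      have aux : ∀ x ∈ interiorSpan k b D, wImage k D ^ l * x ∈ interiorSpan k b D := by
        intro x hx
        induction l with
        | zero => simpa using hx
        | succ l ih =>
          have := mul_param_X_mem_interiorSpan hD 2 ih
          rw [param_X_two] at this
          rwa [pow_succ, mul_right_comm]
      fin_cases i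
      · refine Submodule.mem_sup_left (aux _ ?_)
        simp only [Fin.zero_eta, param_X_zero]
        exact mon_mem_interiorSpan ⟨by omega, by omega, by simp [Nat.ModEq]⟩
      · refine Submodule.mem_sup_left (aux _ ?_)
        simp only [Fin.mk_one, param_X_one]
        refine mon_mem_interiorSpan ⟨by omega, by omega, ?_⟩
        have : (b + 1) * (a + 1) = 1 + D := by rw [hD]; ring
        rw [this]
        simp [Nat.ModEq]
      · refine Submodule.mem_sup_right (Submodule.subset_span ⟨l + 1, ?_⟩)
        simp [pow_succ]
    induction hy using Submodule.span_induction with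
    | mem x h => obtain ⟨l, rfl⟩ := h; exact key l
    | zero => simp
    | add x₁ x₂ _ _ h₁ h₂ => rw [add_mul]; exact add_mem h₁ h₂
    | smul c x _ h => rw [smul_mul_assoc]; exact Submodule.smul_mem _ c h

end Range

/-- The length of the row of height `B` in the staircase region of exponents that survive modulo
`(U ^ q, V ^ q, W ^ q)`. -/
def rowLength (a b D q B : ℕ) : ℕ :=
  q + if B < q then D * q else if B < q * (a + 1) then q * b else 0

lemma le_mul_or (a b D q : ℕ) (hD : D = a * b + a + b) (hpos : 0 < D) :
    q ≤ D * q ∧ q * b ≤ D * q ∧ q * a ≤ D * q ∧ (q * b = 0 ∨ q * a + q ≤ D * q) ∧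
      (q * a = 0 ∨ q * b + q ≤ D * q) := by
  have hb : b ≤ D := by rw [hD]; exact Nat.le_add_left _ _
  have ha : a ≤ D := by rw [hD]; nlinarith [Nat.zero_le (a * b)]
  refine ⟨Nat.le_mul_of_pos_left q hpos, ?_, ?_, ?_, ?_⟩
  · rw [mul_comm]; gcongr
  · rw [mul_comm]; gcongr
  · obtain rfl | hb0 := Nat.eq_zero_or_pos b
    · simp
    · right
      have : a + 1 ≤ D := by rw [hD]; nlinarith [Nat.zero_le (a * b)]
      calc q * a + q = (a + 1) * q := by ring
        _ ≤ D * q := by gcongr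
  · obtain rfl | ha0 := Nat.eq_zero_or_pos a
    · simp
    · right
      have : b + 1 ≤ D := by rw [hD]; nlinarith [Nat.zero_le (a * b)]
      calc q * b + q = (b + 1) * q := by ring
        _ ≤ D * q := by gcongr

section UpperBound

variable {a b D q : ℕ}

/-- A subspace which is stable under the reductions modulo `(U ^ q, V ^ q, W ^ q)` and contains the
monomials of the staircase region contains all interior monomials. -/
lemma mon_mem_of_reductions (hD : D = a * b + a + b) (hpos : 0 < D)
    (Y : Submodule k (AddMonoidAlgebra k (ℕ × ℕ)))
    (hU : ∀ A B, IsInterior b D A B → mon k (A + q * (b + 1)) (B + q) ∈ Y)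
    (hV : ∀ A B, IsInterior b D A B → mon k (A + q) (B + q * (a + 1)) ∈ Y)
    (hW : ∀ A B, IsInterior b D A B → mon k (A + D * q) B + mon k A (B + D * q) ∈ Y)
    (hT : ∀ A B, IsInterior b D A B → B ≤ D * q → A ≤ rowLength a b D q (B - 1) → mon k A B ∈ Y)
    {A B : ℕ} (h : IsInterior b D A B) : mon k A B ∈ Y := by
  have ea : q * (a + 1) = q * a + q := by ring
  have eb : q * (b + 1) = q * b + q := by ring
  obtain ⟨l1, l2, l3, l4, l5⟩ := le_mul_or a b D q hD hpos
  have cU : ∀ A B, IsInterior b D A B → q * (b + 1) < A → q < B → mon k A B ∈ Y := by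
    intro A B h hA hB
    obtain ⟨A, rfl⟩ := Nat.exists_eq_add_of_le' hA.le
    obtain ⟨B, rfl⟩ := Nat.exists_eq_add_of_le' hB.le
    exact hU A B (h.of_mul_zero (by omega) (by omega))
  have cV : ∀ A B, IsInterior b D A B → q < A → q * (a + 1) < B → mon k A B ∈ Y := by
    intro A B h hA hB
    obtain ⟨A, rfl⟩ := Nat.exists_eq_add_of_le' hA.le
    obtain ⟨B, rfl⟩ := Nat.exists_eq_add_of_le' hB.le
    exact hV A B (h.of_mul_one hD (by omega) (by omega))
  have shift : ∀ A B, IsInterior b D A B → mon k A (B + D * q) ∈ Y →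
      mon k (A + D * q) B ∈ Y := fun A B h hm => by
    simpa using sub_mem (hW A B h) hm
  have shift' : ∀ A B, IsInterior b D A B → mon k (A + D * q) B ∈ Y →
      mon k A (B + D * q) ∈ Y := fun A B h hm => by
    simpa using sub_mem (hW A B h) hm
  have far : ∀ A B, IsInterior b D A B → D * q + q < A → mon k A B ∈ Y := by
    intro A B h hA
    obtain hB | hB := lt_or_ge q B
    · exact cU A B h (by omega) hB
    · obtain ⟨A, rfl⟩ := Nat.exists_eq_add_of_le' (show D * q ≤ A by omega)
      have h' := h.of_add_left (by omega)
      refine shift A B h' ?_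
      have := h.2.1
      obtain h0 | h0 := l4
      · exact cU _ _ (h'.add_right q) (by omega) (by omega)
      · exact cV _ _ (h'.add_right q) (by omega) (by omega)
  have far' : ∀ A B, IsInterior b D A B → D * q + q < B → mon k A B ∈ Y := by
    intro A B h hB
    obtain hA | hA := lt_or_ge q A
    · exact cV A B h hA (by omega)
    · obtain ⟨B, rfl⟩ := Nat.exists_eq_add_of_le' (show D * q ≤ B by omega)
      have h' := h.of_add_right (by omega)
      refine shift' A B h' ?_
      have := h.1
      obtain h0 | h0 := l5
      · exact cV _ _ (h'.add_left q) (by omega) (by omega)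
      · exact cU _ _ (h'.add_left q) (by omega) (by omega)
  have low : ∀ A B, IsInterior b D A B → B ≤ D * q → mon k A B ∈ Y := by
    intro A B h hB
    by_cases hA : A ≤ rowLength a b D q (B - 1)
    · exact hT A B h hB hA
    · have := h.2.1
      unfold rowLength at hA
      split_ifs at hA with h1 h2
      · exact far A B h (by omega)
      · exact cU A B h (by omega) (by omega)
      · exact cV A B h (by omega) (by omega)
  obtain hB | hB := le_or_gt B (D * q)
  · exact low A B h hB
  · obtain ⟨B, rfl⟩ := Nat.exists_eq_add_of_le' hB.le
    obtain hB' | hB' := le_or_gt B (D * q)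
    · have h' := h.of_add_right (by omega)
      exact shift' A B h' (low _ _ (h'.add_left q) hB')
    · exact far' _ _ h (by omega)

/-- The exponents `(A, B + 1)` of monomials that span modulo `(U ^ q, V ^ q, W ^ q)`, together with
powers of `W`. -/
def upperSet (a b D q : ℕ) : Finset (Σ _ : ℕ, ℕ) :=
  (Finset.range (D * q)).sigma fun B => {A ∈ Finset.range (rowLength a b D q B + 1) |
    0 < A ∧ A ≡ (b + 1) * (B + 1) [MOD D]}

/-- The ideal `(U ^ P + V ^ Q + U * V * W, U ^ q, V ^ q, W ^ q)`. -/
def frobIdeal (k : Type*) [Field k] (P Q q : ℕ) : Ideal (MvPolynomial (Fin 3) k) :=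
  tpqRel k P Q ⊔ Ideal.span {X 0 ^ q, X 1 ^ q, X 2 ^ q}

lemma X_pow_mem_frobIdeal (P Q q : ℕ) (i : Fin 3) : X i ^ q ∈ frobIdeal k P Q q :=
  Ideal.mem_sup_right (Ideal.subset_span (by fin_cases i <;> simp))

lemma exists_spanning_finset (hD : D = a * b + a + b) (hpos : 0 < D)
    (hw : wImage k D ^ q = (-1) ^ q * (mon k (D * q) 0 + mon k 0 (D * q))) :
    ∃ S : Finset (MvPolynomial (Fin 3) k), S.card ≤ q + (upperSet a b D q).card ∧
      (frobIdeal k (a + 2) (b + 2) q).restrictScalars k ⊔ Submodule.span k (S : Set _) = ⊤ := by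
  classical
  have hex : ∀ A B, ∃ g, IsInterior b D A B → param k a b D g = mon k A B := by
    intro A B
    by_cases h : IsInterior b D A B
    · obtain ⟨g, hg⟩ := mon_mem_range (k := k) hD h
      exact ⟨g, fun _ => hg⟩
    · exact ⟨0, fun h' => absurd h' h⟩
  choose e he using hex
  let S : Finset (MvPolynomial (Fin 3) k) :=
    (Finset.range q).image (fun l => X 2 ^ l) ∪ (upperSet a b D q).image fun m => e m.2 (m.1 + 1)
  refine ⟨S, ?_, ?_⟩
  · refine (Finset.card_union_le _ _).trans (add_le_add ?_ Finset.card_image_le)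
    simpa using Finset.card_image_le (s := Finset.range q)
      (f := fun l => (X 2 : MvPolynomial (Fin 3) k) ^ l)
  set J := frobIdeal k (a + 2) (b + 2) q with hJ
  set N := J.restrictScalars k ⊔ Submodule.span k (S : Set _) with hN
  let Y := N.map (param k a b D).toLinearMap
  have hJY : ∀ g ∈ J, param k a b D g ∈ Y := fun g hg => ⟨g, Submodule.mem_sup_left hg, rfl⟩
  have hSY : ∀ g ∈ S, param k a b D g ∈ Y := fun g hg =>
    ⟨g, Submodule.mem_sup_right (Submodule.subset_span hg), rfl⟩
  have hint : ∀ A B, IsInterior b D A B → mon k A B ∈ Y := by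
    intro A B h
    refine mon_mem_of_reductions (q := q) hD hpos Y ?_ ?_ ?_ ?_ h
    · intro A B h
      have := hJY _ (J.mul_mem_left (e A B) (X_pow_mem_frobIdeal _ _ q 0))
      simpa [he A B h, mon_pow, mon_mul_mon] using this
    · intro A B h
      have := hJY _ (J.mul_mem_left (e A B) (X_pow_mem_frobIdeal _ _ q 1))
      simpa [he A B h, mon_pow, mon_mul_mon] using this
    · intro A B h
      have := hJY _ (J.mul_mem_left (e A B * (-1) ^ q) (X_pow_mem_frobIdeal _ _ q 2))
      rw [map_mul, map_mul, he A B h, map_pow, map_pow, param_X_two, hw, map_neg, map_one,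
        mul_assoc, ← mul_assoc ((-1) ^ q), ← mul_pow] at this
      simpa [mul_add, mon_mul_mon] using this
    · intro A B h hB hA
      rw [← he A B h]
      refine hSY _ (Finset.mem_union_right _ (Finset.mem_image.2 ⟨⟨B - 1, A⟩, ?_, ?_⟩))
      · have := h.2.1
        have hB1 : B - 1 + 1 = B := by omega
        simp only [upperSet, Finset.mem_sigma, Finset.mem_range, Finset.mem_filter, hB1]
        exact ⟨by omega, by omega, h.1, h.2.2⟩
      · have := h.2.1
        have hB1 : B - 1 + 1 = B := by omega
        simp only [hB1]
  have htop : ∀ g, param k a b D g ∈ Y := by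
    intro g
    have hle : interiorSpan k b D ⊔ Submodule.span k (Set.range fun l : ℕ => wImage k D ^ l) ≤ Y := by
      refine sup_le (Submodule.span_le.2 ?_) (Submodule.span_le.2 ?_)
      · rintro _ ⟨A, B, h, rfl⟩
        exact hint A B h
      · rintro _ ⟨l, rfl⟩
        have hl : wImage k D ^ l = param k a b D (X 2 ^ l) := by simp
        simp only [hl]
        obtain h | h := lt_or_ge l q
        · exact hSY _ (Finset.mem_union_left _ (Finset.mem_image.2 ⟨l, by simpa using h, rfl⟩))
        · exact hJY _ (J.mem_of_dvd (pow_dvd_pow _ h) (X_pow_mem_frobIdeal _ _ q 2))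
    exact hle (param_mem_sup hD g)
  rw [eq_top_iff]
  rintro g -
  obtain ⟨g', hg', hgg'⟩ := htop g
  have hker : g - g' ∈ J := Ideal.mem_sup_left
    ((param_eq_zero_iff hD hpos _).1 (by rw [map_sub, sub_eq_zero]; exact hgg'.symm))
  have : g = (g - g') + g' := by ring
  rw [this]
  exact add_mem (Submodule.mem_sup_left hker) hg'

end UpperBound

section LowerBound

variable {a b D q : ℕ}

/-- The coefficient of `s ^ A * t ^ B`, corrected so as to vanish on multiples of
`s ^ (D * q) + t ^ (D * q)`. -/
def corrCoeff (k : Type*) [Field k] (D q A B : ℕ) : AddMonoidAlgebra k (ℕ × ℕ) →ₗ[k] k where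
  toFun x := x.coeff (A, B) - if D * q ≤ A then x.coeff (A - D * q, B + D * q) else 0
  map_add' x y := by
    simp only [AddMonoidAlgebra.coeff_add, Finsupp.add_apply]
    split_ifs <;> ring
  map_smul' c x := by
    simp only [AddMonoidAlgebra.coeff_smul, Finsupp.smul_apply, smul_eq_mul, RingHom.id_apply]
    split_ifs <;> ring

lemma corrCoeff_mon (A B A' B' : ℕ) : corrCoeff k D q A B (mon k A' B') =
    (if A' = A ∧ B' = B then 1 else 0) -
      if D * q ≤ A ∧ A' = A - D * q ∧ B' = B + D * q then 1 else 0 := by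
  simp only [corrCoeff, LinearMap.coe_mk, AddHom.coe_mk, mon_coeff, Prod.mk.injEq, ite_and]

lemma corrCoeff_mul_eq_zero {A B : ℕ} {y : AddMonoidAlgebra k (ℕ × ℕ)}
    (hy : ∀ c d, corrCoeff k D q A B (mon k c d * y) = 0) (x : AddMonoidAlgebra k (ℕ × ℕ)) :
    corrCoeff k D q A B (x * y) = 0 := by
  induction x using AddMonoidAlgebra.induction_linear with
  | zero => simp
  | add x₁ x₂ h₁ h₂ => rw [add_mul, map_add, h₁, h₂, add_zero]
  | single m r =>
    have : (AddMonoidAlgebra.single m r : AddMonoidAlgebra k (ℕ × ℕ)) = r • mon k m.1 m.2 := by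
      simp [mon]
    rw [this, smul_mul_assoc, map_smul, hy, smul_zero]

/-- The exponents of linearly independent monomials modulo `(U ^ q, V ^ q, W ^ q)`. -/
def lowerSet (a b D q : ℕ) : Finset (Σ _ : ℕ, ℕ) :=
  (Finset.range (D * q)).sigma fun B => {A ∈ Finset.range (rowLength a b D q B) |
    0 < A ∧ 0 < B ∧ A ≡ (b + 1) * B [MOD D]}

lemma corrCoeff_param_eq_zero (hD : D = a * b + a + b) (hpos : 0 < D)
    (hw : wImage k D ^ q = (-1) ^ q * (mon k (D * q) 0 + mon k 0 (D * q)))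
    {A B : ℕ} (hB : B < D * q) (hA : A < rowLength a b D q B) {g : MvPolynomial (Fin 3) k}
    (hg : g ∈ frobIdeal k (a + 2) (b + 2) q) : corrCoeff k D q A B (param k a b D g) = 0 := by
  have ea : q * (a + 1) = q * a + q := by ring
  have eb : q * (b + 1) = q * b + q := by ring
  obtain ⟨l1, l2, l3, l4, l5⟩ := le_mul_or a b D q hD hpos
  have hA' : A < D * q + q ∧ (q ≤ B → A < q * b + q) ∧ (q * a + q ≤ B → A < q) := by
    unfold rowLength at hA
    split_ifs at hA <;> omega
  clear hA
  obtain ⟨g₁, hg₁, g₂, hg₂, rfl⟩ := Submodule.mem_sup.1 hg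
  obtain ⟨r, s, t, rfl⟩ := Submodule.mem_span_triple.1 hg₂
  have hU : ∀ c d, corrCoeff k D q A B (mon k c d * mon k (b + 1) 1 ^ q) = 0 := by
    intro c d
    rw [mon_pow, mon_mul_mon, corrCoeff_mon, if_neg (by omega), if_neg (by omega), sub_zero]
  have hV : ∀ c d, corrCoeff k D q A B (mon k c d * mon k 1 (a + 1) ^ q) = 0 := by
    intro c d
    rw [mon_pow, mon_mul_mon, corrCoeff_mon, if_neg (by omega), if_neg (by omega), sub_zero]
  have hW : ∀ c d,
      corrCoeff k D q A B (mon k c d * (mon k (D * q) 0 + mon k 0 (D * q))) = 0 := by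
    intro c d
    rw [mul_add, mon_mul_mon, mon_mul_mon, map_add, corrCoeff_mon, corrCoeff_mon]
    rw [if_neg (c := D * q ≤ A ∧ c + D * q = A - D * q ∧ d + 0 = B + D * q) (by omega),
      if_neg (c := c + 0 = A ∧ d + D * q = B) (by omega), sub_zero, zero_sub, ← sub_eq_add_neg,
      sub_eq_zero]
    exact if_congr (by omega) rfl rfl
  simp only [map_add, smul_eq_mul, map_mul, map_pow, param_X_zero, param_X_one, param_X_two]
  rw [(param_eq_zero_iff hD hpos g₁).2 hg₁, map_zero, corrCoeff_mul_eq_zero hU,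
    corrCoeff_mul_eq_zero hV, hw, ← mul_assoc, corrCoeff_mul_eq_zero hW]
  simp

/-- The corrected coefficients at the exponents in `lowerSet`. -/
def corrCoeffs (k : Type*) [Field k] (a b D q : ℕ) :
    MvPolynomial (Fin 3) k →ₗ[k] (lowerSet a b D q → k) :=
  (LinearMap.pi fun m : lowerSet a b D q => corrCoeff k D q m.1.2 m.1.1) ∘ₗ
    (param k a b D).toLinearMap

lemma corrCoeffs_surjective (hD : D = a * b + a + b) :
    Function.Surjective (corrCoeffs k a b D q) := by
  classical
  rw [← LinearMap.range_eq_top, eq_top_iff, ← (Pi.basisFun k (lowerSet a b D q)).span_eq,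
    Submodule.span_le]
  rintro _ ⟨⟨⟨B, A⟩, hm⟩, rfl⟩
  have hm' := hm
  simp only [lowerSet, Finset.mem_sigma, Finset.mem_range, Finset.mem_filter] at hm'
  obtain ⟨hB, -, hA, hB0, hmod⟩ := hm'
  obtain ⟨g, hg⟩ := mon_mem_range (k := k) hD ⟨hA, hB0, hmod⟩
  refine ⟨g, ?_⟩
  ext ⟨⟨B', A'⟩, hm''⟩
  have hg' : (param k a b D) g = mon k A B := hg
  simp only [corrCoeffs, LinearMap.comp_apply, AlgHom.toLinearMap_apply, LinearMap.pi_apply, hg',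
    corrCoeff_mon, Pi.basisFun_apply, Pi.single_apply, Subtype.mk.injEq, Sigma.mk.injEq, heq_eq_eq]
  rw [if_neg (c := D * q ≤ A' ∧ A = A' - D * q ∧ B = B' + D * q) (by omega), sub_zero]
  exact if_congr (by omega) rfl rfl

end LowerBound

/-- Bounds for the colength of the Frobenius power, in terms of lattice point counts. -/
lemma finrank_bounds {a b D q : ℕ} (hD : D = a * b + a + b) (hpos : 0 < D)
    (hw : wImage k D ^ q = (-1) ^ q * (mon k (D * q) 0 + mon k 0 (D * q)))
    {Z : Type*} [AddCommGroup Z] [Module k Z] (π : MvPolynomial (Fin 3) k →ₗ[k] Z)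
    (hπ : Function.Surjective π)
    (hker : LinearMap.ker π = (frobIdeal k (a + 2) (b + 2) q).restrictScalars k) :
    (lowerSet a b D q).card ≤ Module.finrank k Z ∧
      Module.finrank k Z ≤ q + (upperSet a b D q).card := by
  classical
  obtain ⟨S, hS, hspan⟩ := exists_spanning_finset hD hpos hw
  have htop : Submodule.span k ((S.image π : Finset Z) : Set Z) = ⊤ := by
    rw [Finset.coe_image, ← Submodule.map_span,
      LinearMap.map_eq_top_iff (LinearMap.range_eq_top.2 hπ), hker, sup_comm, hspan]
  have hfin : Module.Finite k Z := ⟨⟨_, htop⟩⟩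
  constructor
  · have hle : LinearMap.ker π ≤ LinearMap.ker (corrCoeffs k a b D q) := by
      intro g hg
      rw [hker] at hg
      ext ⟨⟨B, A⟩, hm⟩
      simp only [lowerSet, Finset.mem_sigma, Finset.mem_range, Finset.mem_filter] at hm
      exact corrCoeff_param_eq_zero hD hpos hw hm.1 hm.2.1 hg
    let F := (LinearMap.ker π).liftQ (corrCoeffs k a b D q) hle ∘ₗ
      (π.quotKerEquivOfSurjective hπ).symm.toLinearMap
    have hF : Function.Surjective F := by
      intro v
      obtain ⟨g, rfl⟩ := corrCoeffs_surjective hD v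
      refine ⟨π g, ?_⟩
      simp only [F, LinearMap.comp_apply, LinearEquiv.coe_coe]
      have : (π.quotKerEquivOfSurjective hπ).symm (π g) = (LinearMap.ker π).mkQ g := by
        rw [LinearEquiv.symm_apply_eq]; rfl
      rw [this, Submodule.mkQ_apply, Submodule.liftQ_apply]
    simpa using LinearMap.finrank_le_finrank_of_surjective hF
  · rw [← finrank_top k Z, ← htop]
    exact (finrank_span_finset_le_card (R := k) (S.image π)).trans (Finset.card_image_le.trans hS)

/-- `finrank_bounds` for the iterated quotient `R/m^[q]`. -/
lemma finrank_colength_bounds {a b D q : ℕ} (hD : D = a * b + a + b) (hpos : 0 < D)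
    (hw : wImage k D ^ q = (-1) ^ q * (mon k (D * q) 0 + mon k 0 (D * q))) :
    let R := MvPolynomial (Fin 3) k ⧸ tpqRel k (a + 2) (b + 2)
    let c := Module.finrank k (R ⧸ Ideal.span
      {Ideal.Quotient.mk (tpqRel k (a + 2) (b + 2)) (X 0) ^ q,
        Ideal.Quotient.mk (tpqRel k (a + 2) (b + 2)) (X 1) ^ q,
        Ideal.Quotient.mk (tpqRel k (a + 2) (b + 2)) (X 2) ^ q})
    (lowerSet a b D q).card ≤ c ∧ c ≤ q + (upperSet a b D q).card := by
  intro R c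
  let I := tpqRel k (a + 2) (b + 2)
  let I' : Ideal R := Ideal.span {Ideal.Quotient.mk I (X 0) ^ q, Ideal.Quotient.mk I (X 1) ^ q,
    Ideal.Quotient.mk I (X 2) ^ q}
  refine finrank_bounds hD hpos hw
    ((Ideal.Quotient.mkₐ k I').comp (Ideal.Quotient.mkₐ k I)).toLinearMap ?_ ?_
  · exact (Ideal.Quotient.mkₐ_surjective k I').comp (Ideal.Quotient.mkₐ_surjective k I)
  · have hI' : I' = (Ideal.span {X 0 ^ q, X 1 ^ q, X 2 ^ q}).map (Ideal.Quotient.mk I) := by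
      rw [Ideal.map_span]
      simp only [Set.image_insert_eq, Set.image_singleton, map_pow]
      rfl
    ext g
    have h1 : g ∈ LinearMap.ker
        ((Ideal.Quotient.mkₐ k I').comp (Ideal.Quotient.mkₐ k I)).toLinearMap ↔
        Ideal.Quotient.mk I g ∈ I' := Ideal.Quotient.eq_zero_iff_mem
    rw [h1, hI', ← Ideal.mem_comap, Ideal.comap_map_of_surjective' _ Ideal.Quotient.mk_surjective,
      Ideal.mk_ker, sup_comm]
    rfl

/-- The Frobenius power of the image of `W`. -/
lemma wImage_pow (p : ℕ) [Fact p.Prime] [CharP k p] (D e : ℕ) :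
    wImage k D ^ p ^ e =
      (-1) ^ p ^ e * (mon k (D * p ^ e) 0 + mon k 0 (D * p ^ e)) := by
  have : CharP (AddMonoidAlgebra k (ℕ × ℕ)) p :=
    charP_of_injective_algebraMap (algebraMap k (AddMonoidAlgebra k (ℕ × ℕ))).injective p
  rw [wImage, neg_pow, add_pow_char_pow, mon_pow, mon_pow]
  simp [mul_comm]

section Counting

variable {a b D q : ℕ}

lemma sum_rowLength (hD : D = a * b + a + b) (hpos : 0 < D) :
    ∑ B ∈ Finset.range (D * q), rowLength a b D q B = q ^ 2 * (2 * D + a * b) := by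
  obtain ⟨l1, l2, l3, l4, l5⟩ := le_mul_or a b D q hD hpos
  have key : ∀ n, n ≤ D * q → ∑ B ∈ Finset.range n, rowLength a b D q B =
      n * q + min n q * (D * q) + (min n (q * (a + 1)) - q) * (q * b) := by
    intro n _
    have ea : q * (a + 1) = q * a + q := by ring
    induction n with
    | zero => simp
    | succ n ih =>
      rw [Finset.sum_range_succ, ih (by omega), rowLength]
      split_ifs with h1 h2
      · have e1 : min n q = n := by omega
        have e2 : min (n + 1) q = n + 1 := by omega
        have e3 : min n (q * (a + 1)) - q = 0 := by omega
        have e4 : min (n + 1) (q * (a + 1)) - q = 0 := by omega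
        rw [e1, e2, e3, e4]; ring
      · have e1 : min n q = q := by omega
        have e2 : min (n + 1) q = q := by omega
        have e4 : min (n + 1) (q * (a + 1)) - q = min n (q * (a + 1)) - q + 1 := by omega
        rw [e1, e2, e4]; ring
      · have e1 : min n q = q := by omega
        have e2 : min (n + 1) q = q := by omega
        have e4 : min (n + 1) (q * (a + 1)) - q = min n (q * (a + 1)) - q := by omega
        rw [e1, e2, e4]; ring
  rw [key _ le_rfl, min_eq_right l1]
  have e : (min (D * q) (q * (a + 1)) - q) * (q * b) = q * a * (q * b) := by
    obtain h | h := l4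
    · simp [h]
    · have : q * (a + 1) = q * a + q := by ring
      rw [this, min_eq_right h, Nat.add_sub_cancel]
  rw [e]; ring

lemma card_filter_modEq_bounds (hpos : 0 < D) (n v : ℕ) :
    (n : ℝ) / D - 1 ≤ ({A ∈ Finset.range n | A ≡ v [MOD D]}.card : ℝ) ∧
      ({A ∈ Finset.range n | A ≡ v [MOD D]}.card : ℝ) ≤ (n : ℝ) / D + 1 := by
  rw [← Nat.count_eq_card_filter_range, Nat.count_modEq_card _ hpos]
  have h1 : ((n / D : ℕ) : ℝ) ≤ (n : ℝ) / D := Nat.cast_div_le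
  have h2 : (n : ℝ) / D < ((n / D : ℕ) : ℝ) + 1 := by
    rw [← Nat.floor_div_eq_div (K := ℝ)]
    exact Nat.lt_floor_add_one _
  split_ifs <;> push_cast <;> constructor <;> linarith

lemma card_upperSet_le (hD : D = a * b + a + b) (hpos : 0 < D) :
    ((upperSet a b D q).card : ℝ) ≤ q ^ 2 * (2 * D + a * b) / D + 2 * D * q := by
  have hD1 : (1 : ℝ) ≤ D := by exact_mod_cast hpos
  have hrow : ∀ B ∈ Finset.range (D * q), (({A ∈ Finset.range (rowLength a b D q B + 1) |
      0 < A ∧ A ≡ (b + 1) * (B + 1) [MOD D]}.card : ℕ) : ℝ) ≤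
      (rowLength a b D q B : ℝ) / D + 2 := by
    intro B _
    refine le_trans (Nat.cast_le.2 (Finset.card_le_card (Finset.monotone_filter_right _
      fun A _ h => h.2))) ((card_filter_modEq_bounds hpos _ _).2.trans ?_)
    have : (1 : ℝ) / D ≤ 1 := by rw [div_le_one (by linarith)]; exact hD1
    push_cast
    rw [add_div]
    linarith
  rw [upperSet, Finset.card_sigma, Nat.cast_sum]
  refine (Finset.sum_le_sum hrow).trans (le_of_eq ?_)
  rw [Finset.sum_add_distrib, ← Finset.sum_div, ← Nat.cast_sum, sum_rowLength hD hpos]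
  simp
  ring

lemma le_card_lowerSet (hD : D = a * b + a + b) (hpos : 0 < D) :
    (q : ℝ) ^ 2 * (2 * D + a * b) / D - (2 * D + 2) * q ≤ ((lowerSet a b D q).card : ℝ) := by
  have hD1 : (1 : ℝ) ≤ D := by exact_mod_cast hpos
  have hrow : ∀ B ∈ Finset.range (D * q), (rowLength a b D q B : ℝ) / D - 2 -
      (if B = 0 then 2 * (q : ℝ) else 0) ≤ (({A ∈ Finset.range (rowLength a b D q B) |
      0 < A ∧ 0 < B ∧ A ≡ (b + 1) * B [MOD D]}.card : ℕ) : ℝ) := by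
    intro B hB
    obtain rfl | hB0 := Nat.eq_zero_or_pos B
    · refine le_trans ?_ (Nat.cast_nonneg _)
      have hq : 0 < q := Nat.pos_of_mul_pos_left (a := D) (by simpa using hB)
      rw [rowLength, if_pos hq, if_pos rfl]
      push_cast
      have : ((q : ℝ) + D * q) / D ≤ 2 * q := by
        rw [div_le_iff₀ (by linarith)]
        nlinarith [(Nat.cast_nonneg q : (0 : ℝ) ≤ q)]
      linarith
    · rw [if_neg hB0.ne']
      have hsub : {A ∈ Finset.range (rowLength a b D q B) | A ≡ (b + 1) * B [MOD D]} ⊆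
          insert 0 {A ∈ Finset.range (rowLength a b D q B) |
            0 < A ∧ 0 < B ∧ A ≡ (b + 1) * B [MOD D]} := by
        intro A hA
        simp only [Finset.mem_filter, Finset.mem_insert] at hA ⊢
        obtain h0 | h0 := Nat.eq_zero_or_pos A
        · exact Or.inl h0
        · exact Or.inr ⟨hA.1, h0, hB0, hA.2⟩
      have h1 : (({A ∈ Finset.range (rowLength a b D q B) | A ≡ (b + 1) * B [MOD D]}.card : ℕ) : ℝ)
          ≤ (({A ∈ Finset.range (rowLength a b D q B) |
            0 < A ∧ 0 < B ∧ A ≡ (b + 1) * B [MOD D]}.card : ℕ) : ℝ) + 1 := by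
        exact_mod_cast (Finset.card_le_card hsub).trans (Finset.card_insert_le _ _)
      have h2 := (card_filter_modEq_bounds hpos (rowLength a b D q B) ((b + 1) * B)).1
      linarith
  rw [lowerSet, Finset.card_sigma, Nat.cast_sum]
  refine le_trans ?_ (Finset.sum_le_sum hrow)
  rw [Finset.sum_sub_distrib, Finset.sum_sub_distrib, ← Finset.sum_div, ← Nat.cast_sum,
    sum_rowLength hD hpos, Finset.sum_ite_eq']
  have : (if 0 ∈ Finset.range (D * q) then 2 * (q : ℝ) else 0) ≤ 2 * q := by
    split_ifs
    · exact le_rfl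
    · positivity
  simp only [Finset.sum_const, Finset.card_range, nsmul_eq_mul]
  push_cast
  linarith

end Counting

end Tpq

/-- For `P, Q ≥ 2` with `P + Q > 4` and `R = k[U,V,W]/(U^P + V^Q + UVW)` over an
algebraically closed field of characteristic `p > 0`, the Hilbert–Kunz multiplicity
of `R` is `3 - (P+Q-4)/(PQ-P-Q)`, and this number lies in `[2,3)`. -/
theorem stmt10 (k : Type*) [Field k] [IsAlgClosed k] (p : ℕ) (hp : p.Prime) [CharP k p]
    (P Q : ℕ) (hP : 2 ≤ P) (hQ : 2 ≤ Q) (hPQ : 4 < P + Q) :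
    Filter.Tendsto
        (fun e : ℕ =>
          (Module.finrank k
              ((MvPolynomial (Fin 3) k ⧸ tpqRel k P Q) ⧸
                Ideal.span {Ideal.Quotient.mk (tpqRel k P Q) (X 0) ^ p ^ e,
                  Ideal.Quotient.mk (tpqRel k P Q) (X 1) ^ p ^ e,
                  Ideal.Quotient.mk (tpqRel k P Q) (X 2) ^ p ^ e}) : ℝ) / (p : ℝ) ^ (2 * e))
        Filter.atTop
        (nhds (3 - ((P : ℝ) + (Q : ℝ) - 4) / ((P : ℝ) * (Q : ℝ) - (P : ℝ) - (Q : ℝ)))) ∧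
      2 ≤ 3 - ((P : ℝ) + (Q : ℝ) - 4) / ((P : ℝ) * (Q : ℝ) - (P : ℝ) - (Q : ℝ)) ∧
      3 - ((P : ℝ) + (Q : ℝ) - 4) / ((P : ℝ) * (Q : ℝ) - (P : ℝ) - (Q : ℝ)) < 3 := by
  obtain ⟨a, rfl⟩ := Nat.exists_eq_add_of_le' hP
  obtain ⟨b, rfl⟩ := Nat.exists_eq_add_of_le' hQ
  obtain ⟨D, hD⟩ : ∃ D, D = a * b + a + b := ⟨_, rfl⟩
  have hpos : 0 < D := by rw [hD]; have := Nat.zero_le (a * b); omega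
  have hD0 : (0 : ℝ) < D := by exact_mod_cast hpos
  have hDR : ((a + 2 : ℕ) : ℝ) * ((b + 2 : ℕ) : ℝ) - ((a + 2 : ℕ) : ℝ) - ((b + 2 : ℕ) : ℝ) = D := by
    rw [hD]; push_cast; ring
  have hnum : ((a + 2 : ℕ) : ℝ) + ((b + 2 : ℕ) : ℝ) - 4 = a + b := by push_cast; ring
  have hD' : (D : ℝ) = a * b + a + b := by rw [hD]; push_cast; ring
  have hab : (0 : ℝ) < a + b := by exact_mod_cast (show 0 < a + b by omega)
  rw [hDR, hnum]
  refine ⟨?_, ?_, ?_⟩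
  · have : Fact p.Prime := ⟨hp⟩
    have hlim : 3 - ((a : ℝ) + b) / D = (2 * D + a * b) / D := by
      field_simp
      rw [hD']; ring
    rw [hlim]
    have hq0 : ∀ e : ℕ, (0 : ℝ) < (p : ℝ) ^ e := fun e => by
      have : (0 : ℝ) < p := by exact_mod_cast hp.pos
      positivity
    have hbound := fun e : ℕ => Tpq.finrank_colength_bounds hD hpos (Tpq.wImage_pow (k := k) p D e)
    have hupper := fun e : ℕ => Tpq.card_upperSet_le (q := p ^ e) hD hpos
    have hlower := fun e : ℕ => Tpq.le_card_lowerSet (q := p ^ e) hD hpos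
    have hinv : Filter.Tendsto (fun e : ℕ => ((p : ℝ) ^ e)⁻¹) Filter.atTop (nhds 0) :=
      (tendsto_pow_atTop_atTop_of_one_lt (by exact_mod_cast hp.one_lt)).inv_tendsto_atTop
    have hlo : Filter.Tendsto
        (fun e : ℕ => (2 * (D : ℝ) + a * b) / D - (2 * D + 2) * ((p : ℝ) ^ e)⁻¹)
        Filter.atTop (nhds ((2 * D + a * b) / D)) := by
      simpa using (hinv.const_mul (2 * (D : ℝ) + 2)).const_sub ((2 * (D : ℝ) + a * b) / D)
    have hup : Filter.Tendsto
        (fun e : ℕ => (2 * (D : ℝ) + a * b) / D + (2 * D + 1) * ((p : ℝ) ^ e)⁻¹)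
        Filter.atTop (nhds ((2 * D + a * b) / D)) := by
      simpa using (hinv.const_mul (2 * (D : ℝ) + 1)).const_add ((2 * (D : ℝ) + a * b) / D)
    refine tendsto_of_tendsto_of_tendsto_of_le_of_le hlo hup (fun e => ?_) (fun e => ?_)
    · have h1 := (hlower e).trans (Nat.cast_le.2 (hbound e).1)
      have hq := hq0 e
      simp only [mul_comm 2 e, pow_mul]
      rw [le_div_iff₀ (by positivity)]
      refine le_trans (le_of_eq ?_) h1
      push_cast
      field_simp
    · have h1 : _ ≤ (_ : ℝ) := Nat.cast_le.2 (hbound e).2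
      have h2 := hupper e
      have hq := hq0 e
      simp only [mul_comm 2 e, pow_mul]
      rw [div_le_iff₀ (by positivity)]
      refine h1.trans ?_
      push_cast at h2 ⊢
      refine (add_le_add_right h2 _).trans (le_of_eq ?_)
      field_simp
      ring
  · have : ((a : ℝ) + b) / D ≤ 1 := by
      rw [div_le_one hD0, hD']
      have : (0 : ℝ) ≤ a * b := by positivity
      linarith
    linarith
  · have : 0 < ((a : ℝ) + b) / D := by positivity
    linarith
end
end

section
/- Let R = k[X, Y₁,…,Yₙ]/(X^d - F(Y₁,…,Yₙ)) be positively graded with deg X = α, and let V₁,…,V_{m+l} be monomials in the Yⱼ. For a ∈ ℕ write a = dq + r, 0 ≤ r ≤ d-1, and set M_a := Syz_R(X^a V₁,…,X^a V_m, V_{m+1},…,V_{m+l}) and 𝒮_j := Syz_R(F^j V₁,…,F^j V_m, V_{m+1},…,V_{m+l}). Then for every s ∈ ℤ there is a short exact sequence 0 → M_{a+d-2r}(s - αr) → 𝒮_q(s - αr) ⊕ 𝒮_{q+1}(s) → M_a(s) → 0 of graded R-modules. -/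
open MvPolynomial

noncomputable section

/-- The linear map sending a tuple `s` to `∑ i, s i * g i`. -/
def syzMap {R : Type*} [CommRing R] {N : ℕ} (g : Fin N → R) : (Fin N → R) →ₗ[R] R where
  toFun s := ∑ i, s i * g i
  map_add' := by intro s t; simp [add_mul, Finset.sum_add_distrib]
  map_smul' := by intro c s; simp [Finset.mul_sum, mul_assoc]

/-- The first syzygy module of `g 0, …, g (N-1)`. -/
def SyzOf {R : Type*} [CommRing R] {N : ℕ} (g : Fin N → R) : Submodule R (Fin N → R) :=
  LinearMap.ker (syzMap g)

/-- `x ∈ A/I` is (the class of) a weighted-homogeneous polynomial of degree `j`. -/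
def qhom {k : Type*} [Field k] {ν : ℕ} (w : Fin ν → ℤ) (I : Ideal (MvPolynomial (Fin ν) k))
    (j : ℤ) (x : MvPolynomial (Fin ν) k ⧸ I) : Prop :=
  ∃ P : MvPolynomial (Fin ν) k, IsWeightedHomogeneous w P j ∧ Ideal.Quotient.mk I P = x

/-- The generators `x^c·v₁, …, x^c·v_m, v_{m+1}, …, v_{m+l}`. -/
def genTup (m l : ℕ) {R : Type*} [CommRing R] (x : R) (c : ℕ) (v : Fin (m + l) → R) :
    Fin (m + l) → R :=
  fun j => if (j : ℕ) < m then x ^ c * v j else v j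

/-- The (total) degrees of the generators `genTup`: the first `m` get an extra `e`. -/
def degTup (m l : ℕ) (e : ℤ) (dv : Fin (m + l) → ℤ) : Fin (m + l) → ℤ :=
  fun j => if (j : ℕ) < m then e + dv j else dv j

/-- The injection of the short exact sequence. -/
def psiMap (m l d r : ℕ) {R : Type*} [CommRing R] (x : R) (h : Fin (m + l) → R) :
    (Fin (m + l) → R) × (Fin (m + l) → R) :=
  (fun i => if (i : ℕ) < m then x ^ (d - r) * h i else h i,
    fun i => if (i : ℕ) < m then -h i else -(x ^ r * h i))

/-- The surjection of the short exact sequence. -/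
def phiMap (m l d r : ℕ) {R : Type*} [CommRing R] (x : R)
    (fg : (Fin (m + l) → R) × (Fin (m + l) → R)) : Fin (m + l) → R :=
  fun i => if (i : ℕ) < m then fg.1 i + x ^ (d - r) * fg.2 i else x ^ r * fg.1 i + fg.2 i

theorem mem_SyzOf {R : Type*} [CommRing R] {N : ℕ} {g h : Fin N → R} :
    h ∈ SyzOf g ↔ ∑ i, h i * g i = 0 := Iff.rfl

/-- If `h i * g i` is termwise `c • (h' i * g' i)` and `h'` is a syzygy of `g'`, then `h` is a
syzygy of `g`. -/
theorem mem_SyzOf_of_mul_eq {R : Type*} [CommRing R] {N : ℕ} {g h g' h' : Fin N → R} (c : R)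
    (hh : h' ∈ SyzOf g') (e : ∀ i, h i * g i = c * (h' i * g' i)) : h ∈ SyzOf g := by
  rw [mem_SyzOf] at *
  rw [Finset.sum_congr rfl fun i _ => e i, ← Finset.mul_sum, hh, mul_zero]

section Homogeneous

variable {k : Type*} [Field k] {ν : ℕ} {w : Fin ν → ℤ} {I : Ideal (MvPolynomial (Fin ν) k)}

theorem qhom.neg {j : ℤ} {y : MvPolynomial (Fin ν) k ⧸ I} (h : qhom w I j y) :
    qhom w I j (-y) := by
  obtain ⟨P, hP, rfl⟩ := h
  exact ⟨-P, (weightedHomogeneousSubmodule k w j).neg_mem hP, by simp⟩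

theorem qhom.pow_mul {j j' : ℤ} {y : MvPolynomial (Fin ν) k ⧸ I} (h : qhom w I j y)
    (i : Fin ν) (e : ℕ) (hj : j' = w i * e + j) :
    qhom w I j' (Ideal.Quotient.mk I (X i) ^ e * y) := by
  obtain ⟨P, hP, rfl⟩ := h
  refine ⟨X i ^ e * P, ?_, by simp⟩
  have := ((isWeightedHomogeneous_X k w i).pow e).mul hP
  rwa [nsmul_eq_mul, mul_comm (e : ℤ), ← hj] at this

end Homogeneous

section PowerDecomposition

open Polynomial

variable {B R : Type*} [CommRing B] [CommRing R]

theorem exists_degreeLT_decomposition [Nontrivial B] {π : B[X] →+* R}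
    (hπ : Function.Surjective π) {f : B[X]} (hf : f.Monic) (hfπ : π f = 0) {d r : ℕ}
    (hfd : f.natDegree = d) (hr : r < d) (u : R) :
    ∃ s ∈ degreeLT B r, ∃ t ∈ degreeLT B (d - r), u = π s + π Polynomial.X ^ r * π t := by
  obtain ⟨p, rfl⟩ := hπ u
  have hX : (Polynomial.X ^ r : B[X]).Monic := monic_X_pow r
  have hdeg : (p %ₘ f).natDegree < d := by
    rw [← hfd]
    refine natDegree_modByMonic_lt p hf fun h => ?_
    rw [h, natDegree_one] at hfd
    omega
  refine ⟨(p %ₘ f) %ₘ Polynomial.X ^ r, ?_, (p %ₘ f) /ₘ Polynomial.X ^ r, ?_, ?_⟩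
  · rw [mem_degreeLT]
    simpa using degree_modByMonic_lt (p %ₘ f) hX
  · rw [mem_degreeLT]
    refine degree_le_natDegree.trans_lt ?_
    rw [natDegree_divByMonic _ hX, natDegree_X_pow]
    exact_mod_cast (by omega : (p %ₘ f).natDegree - r < d - r)
  · rw [← map_pow, ← map_mul, ← map_add, modByMonic_add_div]
    conv_lhs => rw [← modByMonic_add_div p f]
    simp [hfπ]

theorem eq_zero_of_degreeLT_decomposition [Nontrivial B] {π : B[X] →+* R} {f : B[X]}
    (hf : f.Monic) (hker : ∀ p, π p = 0 → f ∣ p) {d r : ℕ} (hfd : f.natDegree = d) (hr : r < d)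
    {s t : B[X]} (hs : s ∈ degreeLT B r) (ht : t ∈ degreeLT B (d - r))
    (h : π Polynomial.X ^ r * π t + π s = 0) : t = 0 ∧ s = 0 := by
  rw [mem_degreeLT] at hs ht
  rw [← map_pow, ← map_mul, ← map_add] at h
  have hlt : (Polynomial.X ^ r * t + s).degree < f.degree := by
    rw [degree_eq_natDegree hf.ne_zero, hfd]
    refine (degree_add_le _ _).trans_lt (max_lt ?_ (hs.trans (by exact_mod_cast hr)))
    rcases eq_or_ne t 0 with rfl | h0
    · simp
    · rw [mul_comm, (monic_X_pow r).degree_mul, degree_X_pow, degree_eq_natDegree h0]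
      rw [degree_eq_natDegree h0] at ht
      norm_cast at ht ⊢
      omega
  have h0 : Polynomial.X ^ r * t + s = 0 := by
    by_contra hne
    exact hf.not_dvd_of_degree_lt hne hlt (hker _ h)
  have := div_modByMonic_unique (f := 0) t s (monic_X_pow r)
    ⟨by rw [add_comm, h0], by simpa using hs⟩
  simpa [eq_comm] using this

/-- A syzygy of `x ^ (d * q + r) * v₁, …, v_{m+l}` splits according to the `B`-basis
`1, x, …, x ^ (d - 1)` of `R = B[x] / (x ^ d - F)`. -/
theorem phiMap_surjective_of_degreeLT [Nontrivial B] {π : B[X] →+* R}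
    (hπ : Function.Surjective π) (F : B) {d q r m l : ℕ} (hr : r < d)
    (hker : ∀ p, π p = 0 ↔ Polynomial.X ^ d - Polynomial.C F ∣ p) (V : Fin (m + l) → B)
    {u : Fin (m + l) → R}
    (hu : u ∈ SyzOf (genTup m l (π Polynomial.X) (d * q + r) fun j => π (Polynomial.C (V j)))) :
    ∃ f g : Fin (m + l) → R,
      f ∈ SyzOf (genTup m l (π (Polynomial.C F)) q fun j => π (Polynomial.C (V j))) ∧
      g ∈ SyzOf (genTup m l (π (Polynomial.C F)) (q + 1) fun j => π (Polynomial.C (V j))) ∧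
      phiMap m l d r (π Polynomial.X) (f, g) = u := by
  have hd : d ≠ 0 := by omega
  have hf : (Polynomial.X ^ d - Polynomial.C F).Monic := monic_X_pow_sub_C F hd
  have hfd : (Polynomial.X ^ d - Polynomial.C F).natDegree = d := natDegree_X_pow_sub_C
  have hfπ : π (Polynomial.X ^ d - Polynomial.C F) = 0 := (hker _).2 dvd_rfl
  have hxF : π Polynomial.X ^ d = π (Polynomial.C F) := by
    rwa [map_sub, map_pow, sub_eq_zero] at hfπ
  have hrd : d - (d - r) = r := by omega
  have hsplit : ∀ i, ∃ f ∈ degreeLT B (d - r), ∃ g ∈ degreeLT B r,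
      u i = if (i : ℕ) < m then π f + π Polynomial.X ^ (d - r) * π g
        else π Polynomial.X ^ r * π f + π g := by
    intro i
    split_ifs
    · rcases Nat.eq_zero_or_pos r with h0 | hpos
      · obtain ⟨s, hs, t, ht, e⟩ := exists_degreeLT_decomposition hπ hf hfπ hfd hr (u i)
        subst h0
        have hs0 : s = 0 := by simpa [mem_degreeLT, Nat.WithBot.lt_zero_iff] using hs
        exact ⟨t, ht, 0, zero_mem _, by simp [e, hs0]⟩
      · obtain ⟨s, hs, t, ht, e⟩ :=
          exists_degreeLT_decomposition hπ hf hfπ hfd (by omega : d - r < d) (u i)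
        exact ⟨s, hs, t, hrd ▸ ht, e⟩
    · obtain ⟨s, hs, t, ht, e⟩ := exists_degreeLT_decomposition hπ hf hfπ hfd hr (u i)
      exact ⟨t, ht, s, hs, by rw [e, add_comm]⟩
  choose f hf' g hg' e using hsplit
  have hmem : ∀ (c : ℕ) (e : ℕ) (p : Fin (m + l) → B[X]), (∀ i, p i ∈ degreeLT B c) →
      ∑ i, p i * Polynomial.C (genTup m l F e V i) ∈ degreeLT B c := by
    intro c e p hp
    refine Submodule.sum_mem _ fun i _ => ?_
    rw [mul_comm, ← Polynomial.smul_eq_C_mul]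
    exact Submodule.smul_mem _ _ (hp i)
  have hgen : ∀ (e : ℕ) (i : Fin (m + l)),
      π (Polynomial.C (genTup m l F e V i)) =
        genTup m l (π (Polynomial.C F)) e (fun j => π (Polynomial.C (V j))) i := by
    intro e i
    simp only [genTup]
    split_ifs <;> simp
  have key := eq_zero_of_degreeLT_decomposition (π := π) hf (fun p => (hker p).1) hfd hr
    (hmem r (q + 1) g hg') (hmem (d - r) q f hf') (by
      rw [mem_SyzOf] at hu
      rw [← hu, map_sum, map_sum, Finset.mul_sum, ← Finset.sum_add_distrib]
      refine Finset.sum_congr rfl fun i _ => ?_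
      rw [map_mul, map_mul, hgen, hgen, e i]
      simp only [genTup]
      split_ifs
      · have h1 : π Polynomial.X ^ (d * q + r) = π (Polynomial.C F) ^ q * π Polynomial.X ^ r := by
          rw [pow_add, pow_mul, hxF]
        have h2 : π Polynomial.X ^ (d - r) * π Polynomial.X ^ r = π (Polynomial.C F) := by
          rw [← pow_add, Nat.sub_add_cancel hr.le, hxF]
        rw [h1, pow_succ, ← h2]
        ring
      · ring)
  refine ⟨fun i => π (f i), fun i => π (g i), ?_, ?_, ?_⟩
  · rw [mem_SyzOf]
    simpa [hgen] using congrArg π key.1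
  · rw [mem_SyzOf]
    simpa [hgen] using congrArg π key.2
  · ext i
    rw [e i]
    rfl

end PowerDecomposition

theorem finSuccEquiv_eq_C_of_support {k : Type*} [Field k] {n : ℕ}
    {P : MvPolynomial (Fin (n + 1)) k} (hP : ∀ μ ∈ P.support, μ 0 = 0) :
    finSuccEquiv k n P = Polynomial.C ((finSuccEquiv k n P).coeff 0) := by
  apply Polynomial.eq_C_of_natDegree_eq_zero
  rw [natDegree_finSuccEquiv, ← Nat.le_zero, degreeOf_le_iff]
  exact fun μ hμ => (hP μ hμ).le

/-- Let `R = k[X, Y₁,…,Yₙ]/(X^d - F(Y₁,…,Yₙ))` be positively graded with `deg X = w 0`,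
and let `V₁,…,V_{m+l}` be monomials in the `Yⱼ`.  For `a = dq + r`, `0 ≤ r ≤ d-1`, set
`M_c := Syz_R(X^c V₁,…,X^c V_m, V_{m+1},…,V_{m+l})` and
`𝒮_j := Syz_R(F^j V₁,…,F^j V_m, V_{m+1},…,V_{m+l})`.  Then for every `s ∈ ℤ` there is
a short exact sequence of graded `R`-modules
`0 → M_{a+d-2r}(s - αr) → 𝒮_q(s - αr) ⊕ 𝒮_{q+1}(s) → M_a(s) → 0`,
with the explicit maps `ψ`, `φ` below (the grading content is expressed by the
homogeneity clauses: `ψ` has degrees `(0, αr)` and `φ` has degrees `(αr, 0)` on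
the two summands, matching the shifts `(s-αr)` and `(s)`). -/
theorem stmt11 (k : Type*) [Field k] (n : ℕ) (w : Fin (n + 1) → ℕ) (hw : ∀ i, 1 ≤ w i)
    (d : ℕ) (hd : 1 ≤ d) (F : MvPolynomial (Fin (n + 1)) k)
    (hFY : ∀ μ ∈ F.support, μ 0 = 0)
    (hFhom : IsWeightedHomogeneous (fun i => (w i : ℤ)) F ((d * w 0 : ℕ) : ℤ))
    (m l : ℕ) (hm : 1 ≤ m) (hl : 1 ≤ l)
    (V : Fin (m + l) → MvPolynomial (Fin (n + 1)) k) (dv : Fin (m + l) → ℕ)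
    (hV : ∀ j, ∃ μ : Fin (n + 1) →₀ ℕ, μ 0 = 0 ∧ V j = monomial μ 1)
    (hVdeg : ∀ j, IsWeightedHomogeneous (fun i => (w i : ℤ)) (V j) ((dv j : ℤ)))
    (a q r : ℕ) (ha : a = d * q + r) (hr : r < d) :
    ∀ I : Ideal (MvPolynomial (Fin (n + 1)) k), I = Ideal.span {X 0 ^ d - F} →
    ∀ x : MvPolynomial (Fin (n + 1)) k ⧸ I, x = Ideal.Quotient.mk I (X 0) →
    ∀ xF : MvPolynomial (Fin (n + 1)) k ⧸ I, xF = Ideal.Quotient.mk I F →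
    ∀ v : Fin (m + l) → MvPolynomial (Fin (n + 1)) k ⧸ I,
      v = (fun j => Ideal.Quotient.mk I (V j)) →
    ∀ gA' gA gq gq1 : Fin (m + l) → MvPolynomial (Fin (n + 1)) k ⧸ I,
      gA' = genTup m l x (a + d - 2 * r) v → gA = genTup m l x a v →
      gq = genTup m l xF q v → gq1 = genTup m l xF (q + 1) v →
    ∀ DA' DA Dq Dq1 : Fin (m + l) → ℤ,
      DA' = degTup m l (((w 0 : ℕ) : ℤ) * ((a + d - 2 * r : ℕ) : ℤ)) (fun j => (dv j : ℤ)) →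
      DA = degTup m l (((w 0 : ℕ) : ℤ) * (a : ℤ)) (fun j => (dv j : ℤ)) →
      Dq = degTup m l (((w 0 : ℕ) : ℤ) * ((d * q : ℕ) : ℤ)) (fun j => (dv j : ℤ)) →
      Dq1 = degTup m l (((w 0 : ℕ) : ℤ) * ((d * (q + 1) : ℕ) : ℤ)) (fun j => (dv j : ℤ)) →
      -- `ψ` maps `M_{a+d-2r}` into `𝒮_q ⊕ 𝒮_{q+1}` …
      (∀ h ∈ SyzOf gA',
        (psiMap m l d r x h).1 ∈ SyzOf gq ∧ (psiMap m l d r x h).2 ∈ SyzOf gq1) ∧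
      -- … injectively, …
      (∀ h ∈ SyzOf gA', psiMap m l d r x h = 0 → h = 0) ∧
      -- `φ` maps `𝒮_q ⊕ 𝒮_{q+1}` into `M_a` …
      (∀ f g : Fin (m + l) → MvPolynomial (Fin (n + 1)) k ⧸ I,
        f ∈ SyzOf gq → g ∈ SyzOf gq1 → phiMap m l d r x (f, g) ∈ SyzOf gA) ∧
      -- … surjectively, …
      (∀ u ∈ SyzOf gA, ∃ f g : Fin (m + l) → MvPolynomial (Fin (n + 1)) k ⧸ I,
        f ∈ SyzOf gq ∧ g ∈ SyzOf gq1 ∧ phiMap m l d r x (f, g) = u) ∧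
      -- … with exactness in the middle, …
      (∀ f g : Fin (m + l) → MvPolynomial (Fin (n + 1)) k ⧸ I,
        f ∈ SyzOf gq → g ∈ SyzOf gq1 →
          (phiMap m l d r x (f, g) = 0 ↔ ∃ h ∈ SyzOf gA', psiMap m l d r x h = (f, g))) ∧
      -- … and the maps respect the gradings (with the stated shifts):
      (∀ (t : ℤ) (h : Fin (m + l) → MvPolynomial (Fin (n + 1)) k ⧸ I), h ∈ SyzOf gA' →
        (∀ i, qhom (fun i => (w i : ℤ)) I (t - DA' i) (h i)) →
          (∀ i, qhom (fun i => (w i : ℤ)) I (t - Dq i) ((psiMap m l d r x h).1 i)) ∧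
          (∀ i, qhom (fun i => (w i : ℤ)) I (t + ((w 0 : ℕ) : ℤ) * (r : ℤ) - Dq1 i)
            ((psiMap m l d r x h).2 i))) ∧
      (∀ (t : ℤ) (f : Fin (m + l) → MvPolynomial (Fin (n + 1)) k ⧸ I), f ∈ SyzOf gq →
        (∀ i, qhom (fun i => (w i : ℤ)) I (t - Dq i) (f i)) →
          ∀ i, qhom (fun i => (w i : ℤ)) I (t + ((w 0 : ℕ) : ℤ) * (r : ℤ) - DA i)
            (phiMap m l d r x (f, 0) i)) ∧
      (∀ (t : ℤ) (g : Fin (m + l) → MvPolynomial (Fin (n + 1)) k ⧸ I), g ∈ SyzOf gq1 →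
        (∀ i, qhom (fun i => (w i : ℤ)) I (t - Dq1 i) (g i)) →
          ∀ i, qhom (fun i => (w i : ℤ)) I (t - DA i) (phiMap m l d r x (0, g) i)) := by
  rintro I hI x rfl xF rfl v rfl gA' gA gq gq1 rfl rfl rfl rfl DA' DA Dq Dq1 rfl rfl rfl rfl
  have hA' : a + d - 2 * r = d * q + (d - r) := by omega
  have hxF : Ideal.Quotient.mk I (X 0) ^ d = Ideal.Quotient.mk I F := by
    rw [← map_pow, Ideal.Quotient.eq, hI]
    exact Ideal.mem_span_singleton_self _
  have hsurj : ∀ u ∈ SyzOf (genTup m l (Ideal.Quotient.mk I (X 0)) a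
        fun j => Ideal.Quotient.mk I (V j)),
      ∃ f g : Fin (m + l) → MvPolynomial (Fin (n + 1)) k ⧸ I,
        f ∈ SyzOf (genTup m l (Ideal.Quotient.mk I F) q fun j => Ideal.Quotient.mk I (V j)) ∧
        g ∈ SyzOf (genTup m l (Ideal.Quotient.mk I F) (q + 1)
          fun j => Ideal.Quotient.mk I (V j)) ∧
        phiMap m l d r (Ideal.Quotient.mk I (X 0)) (f, g) = u := by
    intro u hu
    set E := finSuccEquiv k n
    let π : Polynomial (MvPolynomial (Fin n) k) →+* MvPolynomial (Fin (n + 1)) k ⧸ I :=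
      (Ideal.Quotient.mk I).comp (E.symm : _ →+* MvPolynomial (Fin (n + 1)) k)
    have hπE : ∀ P, π (E P) = Ideal.Quotient.mk I P := fun P => by simp [π]
    have hπ : Function.Surjective π := fun y => by
      obtain ⟨P, rfl⟩ := Ideal.Quotient.mk_surjective y
      exact ⟨E P, hπE P⟩
    have hEF := finSuccEquiv_eq_C_of_support hFY
    have hEV : ∀ j, E (V j) = Polynomial.C ((E (V j)).coeff 0) := fun j => by
      obtain ⟨μ, hμ, e⟩ := hV j
      refine finSuccEquiv_eq_C_of_support fun μ' hμ' => ?_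
      rw [e] at hμ'
      rw [Finset.mem_singleton.1 (support_monomial_subset hμ'), hμ]
    have hEX : E (X 0) = Polynomial.X := finSuccEquiv_X_zero
    have hker : ∀ p, π p = 0 ↔ Polynomial.X ^ d - Polynomial.C ((E F).coeff 0) ∣ p := by
      intro p
      obtain ⟨P, rfl⟩ := E.surjective p
      rw [hπE, Ideal.Quotient.eq_zero_iff_mem, hI, Ideal.mem_span_singleton, ← hEF, ← hEX,
        ← map_pow, ← map_sub]
      exact (map_dvd_iff E).symm
    have hπV : (fun j => π (Polynomial.C ((E (V j)).coeff 0))) =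
        fun j => Ideal.Quotient.mk I (V j) := by
      funext j
      rw [← hEV, hπE]
    have := phiMap_surjective_of_degreeLT (q := q) hπ ((E F).coeff 0) hr hker
      (fun j => (E (V j)).coeff 0) (u := u)
    rw [hπV, ← hEF, ← hEX, hπE, hπE, ← ha] at this
    exact this hu
  rw [hA']
  generalize hv : (fun j => Ideal.Quotient.mk I (V j)) = v at hsurj ⊢
  generalize hx : Ideal.Quotient.mk I (X 0) = x at hxF hsurj ⊢
  rw [← hxF] at hsurj ⊢
  have hsplit : x ^ d = x ^ r * x ^ (d - r) := by rw [← pow_add, Nat.add_sub_cancel' hr.le]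
  have hcast : ((d - r : ℕ) : ℤ) = d - r := by push_cast [hr.le]; rfl
  refine ⟨fun h hh => ⟨mem_SyzOf_of_mul_eq 1 hh fun i => ?_,
      mem_SyzOf_of_mul_eq (-x ^ r) hh fun i => ?_⟩, fun h _ e => ?_, fun f g hf hg => ?_, hsurj,
    fun f g hf hg => ⟨fun e => ?_, ?_⟩, fun t h _ hh => ⟨fun i => ?_, fun i => ?_⟩,
    fun t f _ hf i => ?_, fun t g _ hg i => ?_⟩
  · simp only [psiMap, genTup]
    split_ifs
    · rw [pow_add, pow_mul]; ring
    · ring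
  · simp only [psiMap, genTup]
    split_ifs
    · rw [pow_succ (x ^ d), pow_add, pow_mul]
      linear_combination (-h i * (x ^ d) ^ q * v i) * hsplit
    · ring
  · ext i
    have h1 := congrFun (congrArg Prod.fst e) i
    have h2 := congrFun (congrArg Prod.snd e) i
    simp only [psiMap] at h1 h2
    split_ifs at h1 h2
    · simpa using h2
    · exact h1
  · rw [mem_SyzOf] at *
    have : ∀ i, phiMap m l d r x (f, g) i * genTup m l x a v i =
        x ^ r * (f i * genTup m l (x ^ d) q v i) + g i * genTup m l (x ^ d) (q + 1) v i := by
      intro i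
      simp only [phiMap, genTup]
      split_ifs
      · rw [ha, pow_succ (x ^ d), pow_add, pow_mul]
        linear_combination (-g i * (x ^ d) ^ q * v i) * hsplit
      · ring
    rw [Finset.sum_congr rfl fun i _ => this i, Finset.sum_add_distrib, ← Finset.mul_sum, hf, hg]
    simp
  · have e' : ∀ i : Fin (m + l), (if (i : ℕ) < m then f i + x ^ (d - r) * g i
        else x ^ r * f i + g i) = 0 := fun i => congrFun e i
    refine ⟨fun i => if (i : ℕ) < m then -g i else f i, mem_SyzOf_of_mul_eq 1 hf fun i => ?_,
      Prod.ext (funext fun i => ?_) (funext fun i => ?_)⟩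
    · have := e' i
      simp only [genTup]
      split_ifs at this ⊢
      · rw [eq_neg_of_add_eq_zero_left this, pow_add, pow_mul]; ring
      · ring
    · have := e' i
      simp only [psiMap]
      split_ifs at this ⊢
      · rw [eq_neg_of_add_eq_zero_left this]; ring
      · rfl
    · have := e' i
      simp only [psiMap]
      split_ifs at this ⊢
      · ring
      · rw [eq_neg_of_add_eq_zero_right this]
  · rintro ⟨h, -, e⟩
    rw [← e]
    ext i
    simp only [phiMap, psiMap, Pi.zero_apply]
    split_ifs <;> ring
  · have := hh i
    simp only [psiMap, degTup] at this ⊢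
    subst hx
    split_ifs at this ⊢
    · exact this.pow_mul 0 _ (by push_cast [hcast]; ring)
    · exact this
  · have := hh i
    simp only [psiMap, degTup] at this ⊢
    subst hx
    split_ifs at this ⊢
    · convert this.neg using 1
      push_cast [hcast]; ring
    · exact (this.pow_mul 0 _ (by ring)).neg
  · have := hf i
    simp only [phiMap, degTup] at this ⊢
    subst hx
    split_ifs at this ⊢
    · simp only [Pi.zero_apply, mul_zero, add_zero]
      convert this using 1
      rw [ha]; push_cast; ring
    · simp only [Pi.zero_apply, add_zero]
      exact this.pow_mul 0 _ (by ring)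
  · have := hg i
    simp only [phiMap, degTup] at this ⊢
    subst hx
    split_ifs at this ⊢
    · simp only [Pi.zero_apply, zero_add]
      exact this.pow_mul 0 _ (by rw [ha]; push_cast [hcast]; ring)
    · simpa only [Pi.zero_apply, mul_zero, zero_add] using this
end
end
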